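/- arXiv:2212.12489 — 3 statements merged into one kernel-verified Lean document; each statement's English description precedes it below -/
import Mathlib

section
/- Let L > 1, λ > 0, a > 0, b ≥ 0 and M ≥ 0. Then as a → 0⁺, ∫_L^∞ e^{−at} t^λ (log log t + M)/(log t)^b dt = (Γ(λ+1) · (log log(1/a) + M)) / (a^{λ+1} · (log(1/a))^b) · (1 + O(log log(1/a) / log(1/a))). -/
open Filter Real Topology MeasureTheory

noncomputable section

theorem abs_exp_sub_one_le_mul (x : ℝ) : |exp x - 1| ≤ |x| * (1 + exp x) := by
  have h1 := Real.add_one_le_exp x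
  have h2 := Real.add_one_le_exp (-x)
  have h3 : exp x * exp (-x) = 1 := by rw [← Real.exp_add]; simp
  have hpos := Real.exp_pos x
  have h4 : exp x * (-x + 1) ≤ 1 := (mul_le_mul_of_nonneg_left h2 hpos.le).trans_eq h3
  rw [abs_le]
  constructor
  · nlinarith [neg_abs_le x, abs_nonneg x, mul_nonneg (abs_nonneg x) hpos.le]
  · nlinarith [le_abs_self x, abs_nonneg x, mul_le_mul_of_nonneg_left (le_abs_self x) hpos.le]

theorem abs_log_le_abs_sub_one_mul {r : ℝ} (hr : 0 < r) : |log r| ≤ |r - 1| * (1 + r⁻¹) := by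
  have h1 := Real.log_le_sub_one_of_pos hr
  have h2 := Real.log_le_sub_one_of_pos (inv_pos.2 hr)
  rw [Real.log_inv] at h2
  have h3 : r⁻¹ - 1 = -(r - 1) * r⁻¹ := by field_simp; ring
  have hi := inv_pos.2 hr
  rw [abs_le]
  constructor
  · nlinarith [mul_le_mul_of_nonneg_right (neg_le_abs (r - 1)) hi.le, abs_nonneg (r - 1)]
  · nlinarith [le_abs_self (r - 1), mul_nonneg (abs_nonneg (r - 1)) hi.le]

theorem abs_rpow_neg_sub_one_le {r b : ℝ} (hr : 0 < r) (hb : 0 ≤ b) :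
    |r ^ (-b) - 1| ≤ b * |log r| * (1 + r ^ (-b)) := by
  have h := abs_exp_sub_one_le_mul (log r * (-b))
  rw [← Real.rpow_def_of_pos hr, abs_mul, abs_neg, abs_of_nonneg hb, mul_comm |log r|] at h
  exact h

theorem mul_two_add_div_mul_le_exp {l lam b w : ℝ} (hl : 0 < l) (hlam : 0 < lam) (hb : 0 ≤ b)
    (hw : 0 ≤ w) :
    w * (2 + w / l) * (1 + (1 + w / l) ^ b) ≤
      4 * ((b + 2) / lam) * (1 + (b + 2) / (l * lam)) ^ (b + 1) * exp (lam * w) := by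
  set δ := lam / (b + 2) with hδ
  have hδ0 : 0 < δ := by positivity
  set K := 1 + (b + 2) / (l * lam) with hK
  have hK1 : 1 ≤ K := le_add_of_nonneg_right (by positivity)
  set e := exp (δ * w) with he
  have he1 : 1 ≤ e := Real.one_le_exp (by positivity)
  have hwe : w ≤ (b + 2) / lam * e := by
    have h := Real.add_one_le_exp (δ * w)
    have h' : w = (b + 2) / lam * (δ * w) := by rw [hδ]; field_simp
    rw [h']
    have : (0:ℝ) ≤ (b + 2) / lam := by positivity
    apply mul_le_mul_of_nonneg_left _ this
    linarith
  have hwl : 1 + w / l ≤ K * e := by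
    have : w / l ≤ (b + 2) / (l * lam) * e := by
      rw [div_le_iff₀ hl]
      calc w ≤ _ := hwe
        _ = _ := by field_simp
    rw [hK]; linarith
  have hp : (1 + w / l) ^ b ≤ K ^ b * e ^ b := by
    rw [← Real.mul_rpow (by linarith) (by linarith)]
    exact Real.rpow_le_rpow (by positivity) hwl hb
  have hp1 : 1 ≤ K ^ b * e ^ b := by
    have h1 := Real.one_le_rpow hK1 hb
    have h2 := Real.one_le_rpow he1 hb
    nlinarith
  have hE : exp (lam * w) = e * e * e ^ b := by
    rw [he, ← Real.exp_add, ← Real.exp_mul, ← Real.exp_add]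
    congr 1
    rw [hδ]; field_simp; ring
  have hw2 : 2 + w / l ≤ 2 * (K * e) := by linarith [div_nonneg hw hl.le]
  calc w * (2 + w / l) * (1 + (1 + w / l) ^ b)
      ≤ ((b + 2) / lam * e) * (2 * (K * e)) * (2 * (K ^ b * e ^ b)) := by
        have : (0:ℝ) ≤ (b + 2) / lam * e := by positivity
        gcongr
        linarith
    _ = _ := by
        rw [hE, Real.rpow_add (by linarith), Real.rpow_one]; ring

theorem abs_log_add_div_rpow_sub_le {l b M s X : ℝ} (hl : 0 < l) (hb : 0 ≤ b) (hM : 0 ≤ M)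
    (hs : l ≤ s) (hX : 0 < X) (hlX : 1 ≤ log X) :
    |(log s + M) / s ^ b - (log X + M) / X ^ b| ≤
      (1 + (1 + M) * b) * (X ^ (-b) * (log X / X)) *
        (|s - X| * (2 + |s - X| / l) * (1 + (1 + |s - X| / l) ^ b)) := by
  have hs0 : 0 < s := hl.trans_le hs
  set w := |s - X| with hw
  have hw0 : 0 ≤ w := abs_nonneg _
  set r := s / X with hr
  have hr0 : 0 < r := by positivity
  have hri : r⁻¹ ≤ 1 + w / l := by
    have h1 : r⁻¹ = 1 + (X - s) / s := by rw [hr]; field_simp; ring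
    have h2 : (X - s) / s ≤ w / s := by
      gcongr
      rw [hw, abs_sub_comm]; exact le_abs_self _
    have h3 : w / s ≤ w / l := by gcongr
    linarith
  have hrb : r ^ (-b) ≤ (1 + w / l) ^ b := by
    rw [Real.rpow_neg hr0.le, ← Real.inv_rpow hr0.le]
    exact Real.rpow_le_rpow (by positivity) hri hb
  have hr1 : |r - 1| = w / X := by
    have : r - 1 = (s - X) / X := by rw [hr]; field_simp
    rw [this, abs_div, abs_of_pos hX]
  have hlog : |log r| ≤ w / X * (2 + w / l) := by
    refine (abs_log_le_abs_sub_one_mul hr0).trans ?_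
    rw [hr1]
    exact mul_le_mul_of_nonneg_left (by linarith) (by positivity)
  have hsX : s = r * X := by rw [hr]; field_simp
  have hdecomp : (log s + M) / s ^ b - (log X + M) / X ^ b =
      X ^ (-b) * (r ^ (-b) * log r + (log X + M) * (r ^ (-b) - 1)) := by
    rw [div_eq_mul_inv, div_eq_mul_inv, ← Real.rpow_neg hs0.le, ← Real.rpow_neg hX.le, hsX,
      Real.mul_rpow hr0.le hX.le, Real.log_mul hr0.ne' hX.ne']
    ring
  have hXb : 0 < X ^ (-b) := by positivity
  have hrb0 : 0 < r ^ (-b) := by positivity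
  rw [hdecomp, abs_mul, abs_of_pos hXb]
  have h1 : |r ^ (-b) * log r + (log X + M) * (r ^ (-b) - 1)| ≤
      |log r| * (1 + r ^ (-b)) * (log X * (1 + (1 + M) * b)) := by
    calc _ ≤ |r ^ (-b) * log r| + |(log X + M) * (r ^ (-b) - 1)| := abs_add_le _ _
      _ = r ^ (-b) * |log r| + (log X + M) * |r ^ (-b) - 1| := by
        rw [abs_mul, abs_mul, abs_of_pos hrb0, abs_of_nonneg (by linarith : 0 ≤ log X + M)]
      _ ≤ (1 + r ^ (-b)) * |log r| + (log X + M) * (b * |log r| * (1 + r ^ (-b))) := by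
        gcongr
        · linarith
        · exact abs_rpow_neg_sub_one_le hr0 hb
      _ = |log r| * (1 + r ^ (-b)) * (1 + (log X + M) * b) := by ring
      _ ≤ _ := by
        gcongr
        nlinarith [mul_nonneg hM hb, mul_nonneg (mul_nonneg hM hb) (sub_nonneg.2 hlX)]
  calc _ ≤ X ^ (-b) * (|log r| * (1 + r ^ (-b)) * (log X * (1 + (1 + M) * b))) := by gcongr
    _ ≤ X ^ (-b) * ((w / X * (2 + w / l)) * (1 + (1 + w / l) ^ b) *
          (log X * (1 + (1 + M) * b))) := by gcongr
    _ = _ := by ring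

theorem exp_mul_abs_log_le {u lam : ℝ} (hu : 0 < u) :
    exp (lam * |log u|) ≤ u ^ lam + u ^ (-lam) := by
  have h1 : 0 < u ^ lam := by positivity
  have h2 : 0 < u ^ (-lam) := by positivity
  rcases abs_choice (log u) with h | h
  · rw [h, mul_comm, ← Real.rpow_def_of_pos hu]; linarith
  · rw [h, show lam * -log u = log u * (-lam) by ring, ← Real.rpow_def_of_pos hu]; linarith

/-- Truncation of `u ↦ (log (X + log u) + M) / (X + log u) ^ b` to `Ioi c` is close to its value
at `u = 1`, uniformly in `u > 0` up to a weight `u ^ lam + u ^ (-lam)`. -/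
theorem exists_indicator_log_sub_le (L lam b M : ℝ) (hL : 1 < L) (hlam : 0 < lam)
    (hb : 0 ≤ b) (hM : 0 ≤ M) :
    ∃ C : ℝ, 0 ≤ C ∧ ∀ X u : ℝ, 0 < X → 1 ≤ log X → 2 * log L ≤ X → 0 < u →
      |(Set.Ioi (exp (-X) * L)).indicator
          (fun u => (log (X + log u) + M) / (X + log u) ^ b) u - (log X + M) / X ^ b| ≤
        C * (X ^ (-b) * (log X / X)) * (u ^ lam + u ^ (-lam)) := by
  set l := log L with hl
  have hl0 : 0 < l := Real.log_pos hL
  set C₁ := (1 + (1 + M) * b) *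
    (4 * ((b + 2) / lam) * (1 + (b + 2) / (l * lam)) ^ (b + 1)) with hC₁
  have hC₁0 : 0 ≤ C₁ := by positivity
  set C₂ := 2 * (1 + M) / lam with hC₂
  have hC₂0 : 0 ≤ C₂ := by positivity
  refine ⟨C₁ + C₂, by positivity, fun X u hX hlX hLX hu => ?_⟩
  have hlogX : 0 < log X := by linarith
  have hP : 0 ≤ X ^ (-b) * (log X / X) := by positivity
  have hexp := exp_mul_abs_log_le (lam := lam) hu
  have hexp0 := Real.exp_pos (lam * |log u|)
  have hmono : ∀ c, c ≤ C₁ + C₂ →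
      c * (X ^ (-b) * (log X / X)) * exp (lam * |log u|) ≤
        (C₁ + C₂) * (X ^ (-b) * (log X / X)) * (u ^ lam + u ^ (-lam)) := by
    intro c hc
    gcongr
  have hlogc : log (exp (-X) * L) = -X + l := by
    rw [Real.log_mul (Real.exp_pos _).ne' (by linarith), Real.log_exp]
  have hc0 : 0 < exp (-X) * L := mul_pos (Real.exp_pos _) (by linarith)
  by_cases hmem : u ∈ Set.Ioi (exp (-X) * L)
  · rw [Set.indicator_of_mem hmem]
    have hs : l ≤ X + log u := by
      have := Real.log_lt_log hc0 hmem
      linarith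
    have h1 := abs_log_add_div_rpow_sub_le hl0 hb hM hs hX hlX
    rw [add_sub_cancel_left] at h1
    have h2 := mul_two_add_div_mul_le_exp hl0 hlam hb (abs_nonneg (log u))
    refine h1.trans (le_trans ?_ (hmono C₁ (by linarith)))
    calc _ ≤ (1 + (1 + M) * b) * (X ^ (-b) * (log X / X)) *
          (4 * ((b + 2) / lam) * (1 + (b + 2) / (l * lam)) ^ (b + 1) * exp (lam * |log u|)) := by
          gcongr
      _ = _ := by rw [hC₁]; ring
  · rw [Set.indicator_of_notMem hmem]
    have hle : log u ≤ -X + l := hlogc ▸ Real.log_le_log hu (not_lt.1 hmem)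
    have hw : X / 2 ≤ |log u| := by
      have := neg_le_abs (log u)
      linarith
    refine le_trans ?_ (hmono C₂ (by linarith))
    have hXb : 0 < X ^ (-b) := by positivity
    rw [zero_sub, abs_neg, div_eq_mul_inv, ← Real.rpow_neg hX.le,
      abs_of_nonneg (by positivity)]
    have h3 : log X + M ≤ (1 + M) * log X := by nlinarith
    have h4 : 1 ≤ 2 / (X * lam) * exp (lam * |log u|) := by
      have := Real.add_one_le_exp (lam * |log u|)
      have h5 : lam * (X / 2) ≤ lam * |log u| := by gcongr
      rw [div_mul_eq_mul_div, le_div_iff₀ (by positivity)]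
      linarith
    calc (log X + M) * X ^ (-b) ≤ ((1 + M) * log X) * X ^ (-b) * 1 := by rw [mul_one]; gcongr
      _ ≤ ((1 + M) * log X) * X ^ (-b) * (2 / (X * lam) * exp (lam * |log u|)) := by gcongr
      _ = _ := by rw [hC₂]; field_simp

/-- The Gamma integral against a truncated slowly varying factor. -/
theorem exists_integral_exp_mul_rpow_mul_log_sub_le (L lam b M : ℝ) (hL : 1 < L) (hlam : 0 < lam)
    (hb : 0 ≤ b) (hM : 0 ≤ M) :
    ∃ C : ℝ, 0 ≤ C ∧ ∀ X : ℝ, 0 < X → 1 ≤ log X → 2 * log L ≤ X →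
      |(∫ u in Set.Ioi (exp (-X) * L),
          exp (-u) * u ^ lam * ((log (X + log u) + M) / (X + log u) ^ b)) -
        Gamma (lam + 1) * ((log X + M) / X ^ b)| ≤ C * (X ^ (-b) * (log X / X)) := by
  obtain ⟨C, hC, hbound⟩ := exists_indicator_log_sub_le L lam b M hL hlam hb hM
  have hint : ∀ p : ℝ, 0 ≤ p → IntegrableOn (fun u => exp (-u) * u ^ p) (Set.Ioi 0) := by
    intro p hp
    simpa using Real.GammaIntegral_convergent (s := p + 1) (by linarith)
  have hW : IntegrableOn (fun u => exp (-u) * u ^ (2 * lam) + exp (-u) * u ^ (0:ℝ))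
      (Set.Ioi 0) := (hint _ (by linarith)).add (hint 0 le_rfl)
  set D := ∫ u in Set.Ioi (0:ℝ), (exp (-u) * u ^ (2 * lam) + exp (-u) * u ^ (0:ℝ)) with hD
  have hD0 : 0 ≤ D := setIntegral_nonneg measurableSet_Ioi fun u hu => by
    have : (0:ℝ) < u := hu
    positivity
  refine ⟨C * D, by positivity, fun X hX hlX hLX => ?_⟩
  set P := X ^ (-b) * (log X / X) with hP
  set φ : ℝ → ℝ := fun u => (log (X + log u) + M) / (X + log u) ^ b with hφ
  set c := exp (-X) * L with hc
  have hc0 : 0 < c := mul_pos (Real.exp_pos _) (by linarith)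
  set A := (log X + M) / X ^ b with hA
  set F : ℝ → ℝ := fun u => exp (-u) * u ^ lam * ((Set.Ioi c).indicator φ u - A) with hF
  have hφm : Measurable φ := by
    have hm : Measurable fun u : ℝ => X + log u := by fun_prop
    exact (hm.log.add_const M).div (hm.pow_const b)
  have hFm : Measurable F := by
    have h1 : Measurable fun u : ℝ => exp (-u) * u ^ lam := by fun_prop
    exact h1.mul ((hφm.indicator measurableSet_Ioi).sub_const A)
  have hFle : ∀ u ∈ Set.Ioi (0:ℝ),
      ‖F u‖ ≤ C * P * (exp (-u) * u ^ (2 * lam) + exp (-u) * u ^ (0:ℝ)) := by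
    intro u hu
    have hu0 : (0:ℝ) < u := hu
    have h1 : 0 < exp (-u) * u ^ lam := by positivity
    rw [hF, Real.norm_eq_abs, abs_mul, abs_of_pos h1]
    calc _ ≤ exp (-u) * u ^ lam * (C * P * (u ^ lam + u ^ (-lam))) := by
          gcongr
          exact hbound X u hX hlX hLX hu0
      _ = C * P * (exp (-u) * (u ^ lam * u ^ lam) + exp (-u) * (u ^ lam * u ^ (-lam))) := by ring
      _ = _ := by
          rw [← Real.rpow_add hu0, ← Real.rpow_add hu0, ← two_mul, add_neg_cancel]
  have hle_ae : ∀ᵐ u ∂(volume.restrict (Set.Ioi (0:ℝ))),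
      ‖F u‖ ≤ C * P * (exp (-u) * u ^ (2 * lam) + exp (-u) * u ^ (0:ℝ)) :=
    (ae_restrict_iff' measurableSet_Ioi).2 (Eventually.of_forall hFle)
  have hFi : IntegrableOn F (Set.Ioi 0) :=
    (hW.const_mul (C * P)).mono' hFm.aestronglyMeasurable hle_ae
  have hFint : |∫ u in Set.Ioi (0:ℝ), F u| ≤ C * P * D := by
    rw [hD, ← integral_const_mul]
    exact norm_integral_le_of_norm_le (hW.const_mul (C * P)) hle_ae
  have hsplit : (∫ u in Set.Ioi c, exp (-u) * u ^ lam * φ u) =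
      (∫ u in Set.Ioi (0:ℝ), F u) + Gamma (lam + 1) * A := by
    rw [Real.Gamma_eq_integral (by linarith), ← integral_mul_const, add_sub_cancel_right,
      ← integral_add hFi ((hint lam hlam.le).mul_const A)]
    have hsub : Set.Ioi c ⊆ Set.Ioi 0 := Set.Ioi_subset_Ioi hc0.le
    rw [← Set.inter_eq_self_of_subset_right hsub, ← setIntegral_indicator measurableSet_Ioi]
    congr 1
    ext u
    by_cases hu : u ∈ Set.Ioi c
    · simp only [hF, Set.indicator_of_mem hu]; ring
    · simp only [hF, Set.indicator_of_notMem hu]; ring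
  rw [hsplit, add_sub_cancel_right]
  calc _ ≤ _ := hFint
    _ = _ := by ring

theorem integral_exp_neg_mul_mul_rpow_mul_log {a L lam b M : ℝ} (ha : 0 < a) (hL : 0 < L) :
    (∫ t in Set.Ioi L, exp (-a * t) * t ^ lam * (log (log t) + M) / (log t) ^ b) =
      (a ^ (lam + 1))⁻¹ * ∫ u in Set.Ioi (a * L),
        exp (-u) * u ^ lam * ((log (log (1 / a) + log u) + M) / (log (1 / a) + log u) ^ b) := by
  have h := integral_comp_mul_left_Ioi (fun u => exp (-u) * u ^ lam *
    ((log (log (1 / a) + log u) + M) / (log (1 / a) + log u) ^ b)) L ha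
  have hlam : 0 < a ^ lam := by positivity
  rw [Real.rpow_add ha, Real.rpow_one, mul_inv, mul_assoc, ← smul_eq_mul (a := a⁻¹), ← h,
    ← integral_const_mul]
  refine setIntegral_congr_fun measurableSet_Ioi fun t ht => ?_
  have ht0 : 0 < t := hL.trans ht
  have hlog : log (1 / a) + log (a * t) = log t := by
    rw [Real.log_mul ha.ne' ht0.ne', one_div, Real.log_inv]; ring
  simp only [hlog, Real.mul_rpow ha.le ht0.le, neg_mul]
  field_simp

/-- Lemma 4.2: for `L > 1`, `λ > 0`, `b ≥ 0`, `M ≥ 0`, as `a → 0⁺`,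
`∫_L^∞ e^{−at} t^λ (log log t + M)/(log t)^b dt
  = Γ(λ+1)(log log(1/a) + M)/(a^{λ+1} (log(1/a))^b) · (1 + O(log log(1/a)/log(1/a)))`. -/
theorem integral_with_gamma (L lam b M : ℝ) (hL : 1 < L) (hlam : 0 < lam)
    (hb : 0 ≤ b) (hM : 0 ≤ M) :
    ∃ E : ℝ → ℝ,
      (E =O[𝓝[>] (0:ℝ)] fun a => Real.log (Real.log (1/a)) / Real.log (1/a)) ∧
      ∀ᶠ a in 𝓝[>] (0:ℝ),
        (∫ t in Set.Ioi L,
            Real.exp (-a*t) * t ^ lam * (Real.log (Real.log t) + M) / (Real.log t) ^ b) =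
          Real.Gamma (lam + 1) * (Real.log (Real.log (1/a)) + M) /
            (a ^ (lam + 1) * (Real.log (1/a)) ^ b) * (1 + E a) := by
  obtain ⟨C, hC, hbound⟩ :=
    exists_integral_exp_mul_rpow_mul_log_sub_le L lam b M hL hlam hb hM
  have hΓ : 0 < Gamma (lam + 1) := Real.Gamma_pos_of_pos (by linarith)
  have hX : Tendsto (fun a : ℝ => log (1 / a)) (𝓝[>] 0) atTop := by
    simp only [one_div]
    exact Real.tendsto_log_atTop.comp tendsto_inv_nhdsGT_zero
  have hev : ∀ᶠ a in 𝓝[>] (0:ℝ), 0 < a ∧ 0 < log (1 / a) ∧ 1 ≤ log (log (1 / a)) ∧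
      2 * log L ≤ log (1 / a) := by
    filter_upwards [self_mem_nhdsWithin, hX.eventually_gt_atTop 0,
      (Real.tendsto_log_atTop.comp hX).eventually_ge_atTop 1,
      hX.eventually_ge_atTop (2 * log L)] with a h1 h2 h3 h4 using ⟨h1, h2, h3, h4⟩
  refine ⟨fun a => (∫ t in Set.Ioi L,
      exp (-a * t) * t ^ lam * (log (log t) + M) / (log t) ^ b) /
        (Gamma (lam + 1) * (log (log (1 / a)) + M) / (a ^ (lam + 1) * (log (1 / a)) ^ b)) - 1,
    ?_, ?_⟩
  · refine Asymptotics.IsBigO.of_bound (C / Gamma (lam + 1)) ?_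
    filter_upwards [hev] with a ⟨ha, hXa, hlX, hLX⟩
    have h := hbound (log (1 / a)) hXa hlX hLX
    have hea : exp (-log (1 / a)) = a := by
      rw [one_div, Real.log_inv, neg_neg, Real.exp_log ha]
    rw [hea] at h
    rw [integral_exp_neg_mul_mul_rpow_mul_log ha (by linarith)]
    set J := ∫ u in Set.Ioi (a * L),
        exp (-u) * u ^ lam * ((log (log (1 / a) + log u) + M) / (log (1 / a) + log u) ^ b)
    set X := log (1 / a)
    have hXb : 0 < X ^ b := by positivity
    have hA : 0 < log X + M := by linarith
    have hal : 0 < a ^ (lam + 1) := by positivity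
    have hE : (a ^ (lam + 1))⁻¹ * J /
        (Gamma (lam + 1) * (log X + M) / (a ^ (lam + 1) * X ^ b)) - 1 =
        (J - Gamma (lam + 1) * ((log X + M) / X ^ b)) *
          (X ^ b / (Gamma (lam + 1) * (log X + M))) := by
      field_simp
    have hq : 0 < X ^ b / (Gamma (lam + 1) * (log X + M)) := by positivity
    have hr : 0 ≤ log X / X := div_nonneg (by linarith) hXa.le
    rw [hE, Real.norm_eq_abs, Real.norm_eq_abs, abs_mul, abs_of_pos hq, abs_of_nonneg hr]
    calc _ ≤ C * (X ^ (-b) * (log X / X)) * (X ^ b / (Gamma (lam + 1) * (log X + M))) := by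
          gcongr
      _ = C / Gamma (lam + 1) * (log X / X) / (log X + M) := by
          rw [Real.rpow_neg hXa.le]; field_simp
      _ ≤ C / Gamma (lam + 1) * (log X / X) := div_le_self (by positivity) (by linarith)
  · filter_upwards [hev] with a ⟨ha, hXa, hlX, hLX⟩
    have hA : 0 < log (log (1 / a)) + M := by linarith
    have hne : Gamma (lam + 1) * (log (log (1 / a)) + M) /
        (a ^ (lam + 1) * (log (1 / a)) ^ b) ≠ 0 := by positivity
    rw [add_sub_cancel, mul_div_cancel₀ _ hne]

end
end

section
/- Let L > 1 and let f : [L, ∞) → ℝ be a function with f(t) = o(t) as t → ∞. Then as a → 0⁺, ∫_L^∞ e^{−at} f(t) · (log log t)/(log t) dt = o( log log(1/a) / (a² · log(1/a)) ). -/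
open Filter Real Topology MeasureTheory

noncomputable section

/-- On `[L, ∞)` with `L > 1`, the weight `log (log t) / log t` is bounded. -/
lemma abs_log_log_div_log_le {L t : ℝ} (hL : 1 < L) (ht : L ≤ t) :
    |log (log t) / log t| ≤ 1 + ((log L)⁻¹) ^ 2 := by
  have hl : 0 < log L := log_pos hL
  have hlt : log L ≤ log t := log_le_log (by linarith) ht
  have hp : 0 < log t := by linarith
  have hinv : (log t)⁻¹ ≤ (log L)⁻¹ := inv_anti₀ hl hlt
  have hinv0 : 0 < (log t)⁻¹ := inv_pos.2 hp
  have h1 : log (log t) ≤ log t := by linarith [log_le_sub_one_of_pos hp]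
  have h2 : -log (log t) ≤ (log t)⁻¹ := by
    have := log_le_sub_one_of_pos hinv0
    rw [log_inv] at this
    linarith
  have hsq : (log t)⁻¹ ^ 2 ≤ (log L)⁻¹ ^ 2 := pow_le_pow_left₀ hinv0.le hinv 2
  have hc : log t * (log t)⁻¹ = 1 := mul_inv_cancel₀ hp.ne'
  rw [div_eq_mul_inv, abs_le]
  constructor
  · nlinarith [mul_le_mul_of_nonneg_right h2 hinv0.le]
  · nlinarith [mul_le_mul_of_nonneg_right h1 hinv0.le, sq_nonneg (log L)⁻¹]

/-- Beyond `√x` the weight `log (log t) / log t` is at most twice its value at `x`. -/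
lemma abs_log_log_div_log_le_two_mul {x t : ℝ} (hx : exp (exp 1) ≤ √x) (ht : √x ≤ t) :
    |log (log t) / log t| ≤ 2 * (log (log x) / log x) := by
  have hs : 0 < √x := (exp_pos _).trans_le hx
  have hx0 : 0 < x := sqrt_pos.1 hs
  have he : exp 1 ≤ log √x := (le_log_iff_exp_le hs).2 hx
  have hst : log √x ≤ log t := log_le_log hs ht
  have h1 : (1 : ℝ) < exp 1 := by simp
  have hnn : 0 ≤ log (log t) / log t :=
    div_nonneg (log_nonneg (by linarith)) (by linarith)
  rw [abs_of_nonneg hnn]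
  have hanti : log (log t) / log t ≤ log (log √x) / log √x :=
    log_div_self_antitoneOn he (he.trans hst) hst
  refine hanti.trans ?_
  have hsq : log √x = log x / 2 := log_sqrt hx0.le
  have hlx : 0 < log x := by linarith
  have hmono : log (log √x) ≤ log (log x) := log_le_log (by linarith) (by linarith)
  calc log (log √x) / log √x ≤ log (log x) / log √x := by gcongr; linarith
    _ = 2 * (log (log x) / log x) := by rw [hsq]; field_simp

lemma mul_abs_log_log_div_log_le {L x t : ℝ} (hL : 1 < L) (hx : exp (exp 1) ≤ √x)
    (ht : L ≤ t) :
    t * |log (log t) / log t| ≤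
      2 * (log (log x) / log x) * t + (1 + ((log L)⁻¹) ^ 2) * √x := by
  have ht0 : 0 < t := by linarith
  have hC : 0 ≤ 1 + ((log L)⁻¹) ^ 2 := by positivity
  rcases le_total t √x with h | h
  · have hg : 0 ≤ 2 * (log (log x) / log x) :=
      (abs_nonneg _).trans (abs_log_log_div_log_le_two_mul hx le_rfl)
    calc t * |log (log t) / log t| ≤ √x * (1 + ((log L)⁻¹) ^ 2) :=
          mul_le_mul h (abs_log_log_div_log_le hL ht) (abs_nonneg _) (sqrt_nonneg _)
      _ ≤ _ := by nlinarith [mul_nonneg hg ht0.le]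
  · nlinarith [mul_le_mul_of_nonneg_left (abs_log_log_div_log_le_two_mul hx h) ht0.le,
      mul_nonneg hC (sqrt_nonneg x)]

lemma integrableOn_Ioi_exp_neg_mul {a : ℝ} (ha : 0 < a) (L : ℝ) :
    IntegrableOn (fun t : ℝ => exp (-a * t)) (Set.Ioi L) :=
  integrableOn_exp_mul_Ioi (by linarith) L

lemma integral_Ioi_exp_neg_mul_le {a L : ℝ} (ha : 0 < a) (hL : 0 ≤ L) :
    ∫ t in Set.Ioi L, exp (-a * t) ≤ a⁻¹ := by
  rw [integral_exp_mul_Ioi (by linarith), neg_div_neg_eq, div_eq_mul_inv]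
  have : exp (-a * L) ≤ 1 := exp_le_one_iff.2 (by nlinarith)
  exact mul_le_of_le_one_left (by positivity) this

lemma integral_Ioi_exp_neg_mul_mul_self {a : ℝ} (ha : 0 < a) :
    ∫ t in Set.Ioi (0 : ℝ), exp (-a * t) * t = a⁻¹ ^ 2 := by
  have h := integral_rpow_mul_exp_neg_mul_Ioi (a := 2) (r := a) (by norm_num) ha
  have hG : Gamma 2 = 1 := Gamma_two
  rw [hG, mul_one, one_div, rpow_two] at h
  rw [← h]
  refine setIntegral_congr_fun measurableSet_Ioi fun t _ => ?_
  norm_num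
  ring

lemma integrableOn_Ioi_exp_neg_mul_mul_self {a L : ℝ} (ha : 0 < a) (hL : 0 ≤ L) :
    IntegrableOn (fun t : ℝ => exp (-a * t) * t) (Set.Ioi L) := by
  have h : IntegrableOn (fun t : ℝ => exp (-a * t) * t) (Set.Ioi 0) := by
    by_contra hn
    have := integral_Ioi_exp_neg_mul_mul_self ha
    rw [integral_undef hn] at this
    exact (pow_pos (inv_pos.2 ha) 2).ne this
  exact h.mono_set (Set.Ioi_subset_Ioi hL)

lemma integral_Ioi_exp_neg_mul_mul_self_le {a L : ℝ} (ha : 0 < a) (hL : 0 ≤ L) :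
    ∫ t in Set.Ioi L, exp (-a * t) * t ≤ a⁻¹ ^ 2 := by
  rw [← integral_Ioi_exp_neg_mul_mul_self ha]
  refine setIntegral_mono_set (integrableOn_Ioi_exp_neg_mul_mul_self ha le_rfl) ?_
    (Set.Ioi_subset_Ioi hL).eventuallyLE
  filter_upwards [ae_restrict_mem measurableSet_Ioi] with t ht
  exact mul_nonneg (exp_pos _).le (le_of_lt ht)

lemma eventually_le_sqrt_mul_log_log_div_log {C : ℝ} (hC : 0 < C) :
    ∀ᶠ x : ℝ in atTop, C ≤ √x * (log (log x) / log x) := by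
  have h := (isLittleO_log_id_atTop.comp_tendsto tendsto_sqrt_atTop).bound
    (c := (2 * C)⁻¹) (by positivity)
  filter_upwards [h, eventually_ge_atTop (exp (exp 1))] with x hx hxe
  have hx0 : 0 < x := (exp_pos _).trans_le hxe
  have hle : exp 1 ≤ log x := (le_log_iff_exp_le hx0).2 hxe
  have hl : 0 < log x := (exp_pos 1).trans_le hle
  have hll : 1 ≤ log (log x) := (le_log_iff_exp_le hl).2 hle
  simp only [Function.comp_apply, id_eq, norm_eq_abs, abs_of_nonneg (sqrt_nonneg x),
    log_sqrt hx0.le] at hx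
  have hx' := (le_abs_self _).trans hx
  have hmul := mul_le_mul_of_nonneg_left hx' (by positivity : 0 ≤ 2 * C)
  rw [mul_inv_cancel_left₀ (by positivity)] at hmul
  rw [← mul_div_assoc, le_div_iff₀ hl]
  nlinarith [mul_le_mul_of_nonneg_left hll (sqrt_nonneg x)]

/-- Corollary 4.3: if `L > 1` and `f(t) = o(t)` as `t → ∞`, then as `a → 0⁺`,
`∫_L^∞ e^{−at} f(t) (log log t)/(log t) dt = o(log log(1/a)/(a² log(1/a)))`. -/
theorem integral_little_o (L : ℝ) (hL : 1 < L) (f : ℝ → ℝ)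
    (hmeas : Measurable f) (hloc : LocallyIntegrableOn f (Set.Ici L))
    (hf : f =o[atTop] fun t : ℝ => t) :
    (fun a : ℝ => ∫ t in Set.Ioi L,
        Real.exp (-a*t) * f t * (Real.log (Real.log t) / Real.log t))
      =o[𝓝[>] (0:ℝ)]
      fun a : ℝ => Real.log (Real.log (1/a)) / (a^2 * Real.log (1/a)) := by
  rw [Asymptotics.isLittleO_iff]
  intro c hc
  set C : ℝ := 1 + ((log L)⁻¹) ^ 2 with hCdef
  have hC1 : 1 ≤ C := by have := sq_nonneg (log L)⁻¹; linarith
  obtain ⟨T, hT⟩ := eventually_atTop.1 (hf.bound (c := c / 4) (by positivity))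
  have hint : IntegrableOn (fun t => C * |f t|) (Set.Icc L T) :=
    ((hloc.integrableOn_compact_subset Set.Icc_subset_Ici_self isCompact_Icc).abs).const_mul C
  have hint' : Integrable ((Set.Icc L T).indicator fun t => C * |f t|) :=
    hint.integrable_indicator measurableSet_Icc
  set K : ℝ := ∫ t in Set.Ioi L, (Set.Icc L T).indicator (fun t => C * |f t|) t with hK
  have hev : ∀ᶠ x : ℝ in atTop, exp (exp 1) ≤ √x ∧ C ≤ √x * (log (log x) / log x) ∧
      K / (c / 4) ≤ x :=
    (tendsto_sqrt_atTop.eventually_ge_atTop _).and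
      ((eventually_le_sqrt_mul_log_log_div_log (by linarith)).and (eventually_ge_atTop _))
  filter_upwards [tendsto_inv_nhdsGT_zero.eventually hev, self_mem_nhdsWithin]
    with a ⟨hx, hCx, hKx⟩ ha
  replace ha : 0 < a := ha
  rw [one_div]
  set x := a⁻¹ with hxdef
  set g := log (log x) / log x with hg
  have hxpos : 0 < x := inv_pos.2 ha
  have hR : log (log x) / (a ^ 2 * log x) = x ^ 2 * g := by
    rw [hg, hxdef, inv_pow, ← div_eq_inv_mul, div_div, mul_comm (a ^ 2)]
  rw [hR]
  have hsx : 1 ≤ √x := (one_le_exp (exp_pos 1).le).trans hx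
  have hss : √x * √x = x := mul_self_sqrt hxpos.le
  have hg0 : 0 ≤ g := by
    by_contra! hneg
    nlinarith
  have hCR : C * √x * x ≤ x ^ 2 * g := by
    calc C * √x * x ≤ (√x * g) * √x * x := by gcongr
      _ = (√x * √x) * g * x := by ring
      _ = x ^ 2 * g := by rw [hss]; ring
  have hKR : K ≤ c / 4 * (x ^ 2 * g) := by
    have h1 : K ≤ x * (c / 4) := (div_le_iff₀ (by positivity)).1 hKx
    have h2 : x ≤ C * √x * x :=
      le_mul_of_one_le_left hxpos.le (one_le_mul_of_one_le_of_one_le hC1 hsx)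
    nlinarith [h2.trans hCR]
  have hL0 : 0 ≤ L := by linarith
  have hi1 := (integrableOn_Ioi_exp_neg_mul_mul_self ha hL0).const_mul (c / 4 * (2 * g))
  have hi2 := (integrableOn_Ioi_exp_neg_mul ha L).const_mul (c / 4 * (C * √x))
  have hbound := norm_integral_le_of_norm_le
    (f := fun t => exp (-a * t) * f t * (log (log t) / log t))
    ((hi1.add hi2).add hint'.integrableOn)
    (by
      filter_upwards [ae_restrict_mem measurableSet_Ioi] with t ht
      have hLt : L ≤ t := le_of_lt ht
      have ht0 : 0 < t := by linarith
      have hE : 0 < exp (-a * t) := exp_pos _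
      simp only [Pi.add_apply, norm_mul, norm_eq_abs, abs_of_pos hE]
      by_cases htT : t ≤ T
      · rw [Set.indicator_of_mem (show t ∈ Set.Icc L T from ⟨hLt, htT⟩)]
        have hE1 : exp (-a * t) ≤ 1 := exp_le_one_iff.2 (by nlinarith)
        have h1 : exp (-a * t) * |f t| * |log (log t) / log t| ≤ 1 * |f t| * C := by
          gcongr
          exact abs_log_log_div_log_le hL hLt
        have h2 : 0 ≤ c / 4 * (2 * g) * (exp (-a * t) * t) +
            c / 4 * (C * √x) * exp (-a * t) := by positivity
        linarith
      · rw [Set.indicator_of_notMem (fun h => htT h.2), add_zero]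
        have hft := hT t (le_of_not_ge htT)
        rw [norm_eq_abs, norm_eq_abs, abs_of_pos ht0] at hft
        calc exp (-a * t) * |f t| * |log (log t) / log t|
            ≤ exp (-a * t) * (c / 4 * t) * |log (log t) / log t| := by gcongr
          _ = exp (-a * t) * (c / 4) * (t * |log (log t) / log t|) := by ring
          _ ≤ exp (-a * t) * (c / 4) * (2 * g * t + C * √x) := by
              gcongr
              exact mul_abs_log_log_div_log_le hL hx hLt
          _ = _ := by ring)
  refine hbound.trans ?_
  rw [integral_add' (hi1.add hi2) hint'.integrableOn, ← hK, integral_add' hi1 hi2,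
    integral_const_mul, integral_const_mul,
    norm_eq_abs, abs_of_nonneg (by positivity)]
  have e1 := mul_le_mul_of_nonneg_left (integral_Ioi_exp_neg_mul_mul_self_le ha hL0)
    (by positivity : 0 ≤ c / 4 * (2 * g))
  have e2 := mul_le_mul_of_nonneg_left (integral_Ioi_exp_neg_mul_le ha hL0)
    (by positivity : 0 ≤ c / 4 * (C * √x))
  have e3 := mul_le_mul_of_nonneg_left hCR (by positivity : 0 ≤ c / 4)
  rw [← hxdef] at e1 e2
  linarith

end
end

section
/- Let A > 0 and let γ = γ₁ + iγ₂ ∈ ℂ with γ₁ > 0 and γ₂ ≪ γ₁·(log(1/γ₁))^A. Then as γ₁ → 0⁺, ∫_2^∞ (t·log log t / log t)·exp(−γt) dt = (log log(1/γ₁)) / (γ²·log(1/γ₁)) + O( log log(1/γ₁) / (γ₁²·(log(1/γ₁))²) ). -/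
open Filter Real Topology MeasureTheory

noncomputable section

lemma abs_log_le_self_add_inv {x : ℝ} (hx : 0 < x) : |Real.log x| ≤ x + x⁻¹ := by
  have h₁ := Real.log_le_sub_one_of_pos hx
  have h₂ := Real.one_sub_inv_le_log_of_pos hx
  have h₃ := inv_pos.2 hx
  rw [abs_le]
  constructor <;> linarith

lemma abs_log_div_self_le {s : ℝ} (hs : 1 / 2 ≤ s) : |Real.log s / s| ≤ 5 := by
  have h₀ : 0 < s := by linarith
  rw [abs_div, abs_of_pos h₀, div_le_iff₀ h₀]
  have h₁ := abs_log_le_self_add_inv h₀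
  have h₂ : s⁻¹ ≤ 4 * s := by
    rw [inv_le_iff_one_le_mul₀ h₀]
    nlinarith
  linarith

lemma abs_log_sub_log_le {m x y : ℝ} (hm : 0 < m) (hx : m ≤ x) (hy : m ≤ y) :
    |Real.log x - Real.log y| ≤ |x - y| / m := by
  wlog h : y ≤ x generalizing x y
  · rw [abs_sub_comm, abs_sub_comm x]
    exact this hy hx (le_of_not_ge h)
  have hx₀ : 0 < x := hm.trans_le hx
  have hy₀ : 0 < y := hm.trans_le hy
  rw [abs_of_nonneg (sub_nonneg.2 (Real.log_le_log hy₀ h)), abs_of_nonneg (sub_nonneg.2 h),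
    ← Real.log_div hx₀.ne' hy₀.ne']
  calc Real.log (x / y) ≤ x / y - 1 := Real.log_le_sub_one_of_pos (div_pos hx₀ hy₀)
    _ = (x - y) / y := by field_simp
    _ ≤ (x - y) / m := div_le_div_of_nonneg_left (sub_nonneg.2 h) hm hy

lemma abs_log_div_sub_log_div_le {s L : ℝ} (hL : 2 ≤ L) (hlog : 1 ≤ Real.log L)
    (hs : L / 2 ≤ s) :
    |Real.log s / s - Real.log L / L| ≤ 6 * (Real.log L / L ^ 2) * |s - L| := by
  have hL₀ : 0 < L := by linarith
  have hs₀ : 0 < s := by linarith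
  have h₁ : |Real.log s - Real.log L| ≤ |s - L| / (L / 2) :=
    abs_log_sub_log_le (by linarith) hs (by linarith)
  have hsplit : Real.log s / s - Real.log L / L =
      (Real.log s - Real.log L) / s - Real.log L * (s - L) / (s * L) := by
    field_simp
    ring
  rw [hsplit]
  calc _ ≤ |(Real.log s - Real.log L) / s| + |Real.log L * (s - L) / (s * L)| := abs_sub _ _
    _ = |Real.log s - Real.log L| / s + Real.log L * |s - L| / (s * L) := by
      rw [abs_div, abs_div, abs_mul, abs_of_pos hs₀, abs_of_pos (mul_pos hs₀ hL₀),
        abs_of_pos (by linarith : 0 < Real.log L)]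
    _ ≤ |s - L| / (L / 2) / (L / 2) + Real.log L * |s - L| / (L / 2 * L) := by
      have := abs_nonneg (s - L)
      gcongr
    _ = (4 + 2 * Real.log L) * (|s - L| / L ^ 2) := by
      field_simp
      ring
    _ ≤ (6 * Real.log L) * (|s - L| / L ^ 2) := by
      gcongr
      linarith
    _ = _ := by ring

lemma mul_abs_loglog_div_log_sub_le {a t : ℝ} (ha : 0 < a)
    (hL : 2 ≤ Real.log (1 / a)) (hlog : 1 ≤ Real.log (Real.log (1 / a))) (ht : 2 < t) :
    t * |Real.log (Real.log t) / Real.log t -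
        Real.log (Real.log (1 / a)) / Real.log (1 / a)| ≤
      80 * (Real.log (Real.log (1 / a)) / Real.log (1 / a) ^ 2) * (1 / a + a * t ^ 2) := by
  have ht₀ : 0 < t := by linarith
  have hT : Real.exp (Real.log (1 / a)) = 1 / a := Real.exp_log (by positivity)
  have hsub : Real.log t - Real.log (1 / a) = Real.log (t * a) := by
    rw [Real.log_mul ht₀.ne' ha.ne', one_div, Real.log_inv]
    ring
  set L := Real.log (1 / a)
  have hK : 0 < Real.log L / L ^ 2 := by positivity
  rcases le_or_gt (L / 2) (Real.log t) with hs | hs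
  · have h₁ := abs_log_div_sub_log_div_le hL hlog hs
    rw [hsub] at h₁
    have h₂ := abs_log_le_self_add_inv (mul_pos ht₀ ha)
    calc _ ≤ t * (6 * (Real.log L / L ^ 2) * (t * a + (t * a)⁻¹)) := by
          gcongr
          exact h₁.trans (by gcongr)
      _ = 6 * (Real.log L / L ^ 2) * (1 / a + a * t ^ 2) := by
          field_simp
          ring
      _ ≤ _ := by
          gcongr
          norm_num
  · have hhalf : 1 / 2 ≤ Real.log t := by
      have := Real.log_le_log (by norm_num) ht.le
      linarith [Real.log_two_gt_d9]
    have hbound : |Real.log (Real.log t) / Real.log t - Real.log L / L| ≤ 10 := by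
      have h₁ := abs_log_div_self_le hhalf
      have h₂ := abs_log_div_self_le (s := L) (by linarith)
      linarith [abs_sub (Real.log (Real.log t) / Real.log t) (Real.log L / L)]
    have htL : t ≤ Real.exp (L / 2) := by
      rw [← Real.log_le_iff_le_exp ht₀]
      exact hs.le
    have hsq : L ^ 2 / 8 ≤ Real.exp (L / 2) := by
      have := Real.quadratic_le_exp_of_nonneg (x := L / 2) (by linarith)
      nlinarith
    have hmul : Real.exp (L / 2) * Real.exp (L / 2) = 1 / a := by
      rw [← Real.exp_add, add_halves, hT]
    have ht' : t ≤ 8 * (Real.log L / L ^ 2) * (1 / a) := by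
      have h₁ : t * (L ^ 2 / 8) ≤ 1 / a := by
        rw [← hmul]
        gcongr
      calc t = 8 * (1 / L ^ 2) * (t * (L ^ 2 / 8)) := by field_simp
        _ ≤ 8 * (Real.log L / L ^ 2) * (1 / a) := by gcongr
    calc _ ≤ t * 10 := by gcongr
      _ ≤ 8 * (Real.log L / L ^ 2) * (1 / a) * 10 := by gcongr
      _ = 80 * (Real.log L / L ^ 2) * (1 / a) := by ring
      _ ≤ _ := by
        gcongr
        have : 0 ≤ a * t ^ 2 := by positivity
        linarith

lemma integrableOn_pow_mul_exp_neg_mul (n : ℕ) {a : ℝ} (ha : 0 < a) :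
    IntegrableOn (fun t : ℝ => t ^ n * Real.exp (-a * t)) (Set.Ioi 0) := by
  have h := integrableOn_rpow_mul_exp_neg_mul_rpow (s := n) (p := 1) (b := a)
    (by linarith [n.cast_nonneg (α := ℝ)]) one_pos ha
  simpa using h

lemma integral_pow_mul_exp_neg_mul (n : ℕ) {a : ℝ} (ha : 0 < a) :
    ∫ t in Set.Ioi (0 : ℝ), t ^ n * Real.exp (-a * t) = n.factorial / a ^ (n + 1) := by
  have h := Real.integral_rpow_mul_exp_neg_mul_Ioi (a := n + 1) (r := a) (by positivity) ha
  rw [Real.Gamma_nat_eq_factorial, ← Nat.cast_add_one, Real.rpow_natCast] at h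
  simp only [Nat.cast_add_one, add_sub_cancel_right, Real.rpow_natCast] at h
  simp only [neg_mul, h]
  rw [one_div, inv_pow, inv_mul_eq_div]

lemma norm_cexp_neg_mul_ofReal (γ : ℂ) (t : ℝ) :
    ‖Complex.exp (-γ * t)‖ = Real.exp (-γ.re * t) := by
  simp [Complex.norm_exp]

lemma integrableOn_id_mul_cexp_neg_mul {γ : ℂ} (hγ : 0 < γ.re) :
    IntegrableOn (fun t : ℝ => (t : ℂ) * Complex.exp (-γ * t)) (Set.Ioi 0) := by
  refine Integrable.mono' (integrableOn_pow_mul_exp_neg_mul 1 hγ)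
    (Measurable.aestronglyMeasurable (by fun_prop))
    ((ae_restrict_iff' measurableSet_Ioi).2 (Eventually.of_forall fun t ht => ?_))
  rw [norm_mul, norm_cexp_neg_mul_ofReal, Complex.norm_real, Real.norm_eq_abs,
    abs_of_pos ht, pow_one]

lemma tendsto_pow_mul_cexp_neg_mul_atTop (n : ℕ) {γ : ℂ} (hγ : 0 < γ.re) :
    Tendsto (fun t : ℝ => (t : ℂ) ^ n * Complex.exp (-γ * t)) atTop (𝓝 0) := by
  rw [tendsto_zero_iff_norm_tendsto_zero]
  refine (tendsto_rpow_mul_exp_neg_mul_atTop_nhds_zero n γ.re hγ).congr' ?_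
  filter_upwards [eventually_ge_atTop 0] with t ht
  rw [norm_mul, norm_cexp_neg_mul_ofReal, norm_pow, Complex.norm_real,
    Real.norm_of_nonneg ht, Real.rpow_natCast]

lemma integral_id_mul_cexp_neg_mul {γ : ℂ} (hγ : 0 < γ.re) :
    ∫ t in Set.Ioi (0 : ℝ), (t : ℂ) * Complex.exp (-γ * t) = 1 / γ ^ 2 := by
  have hγ₀ : γ ≠ 0 := by
    rintro rfl
    simp at hγ
  have hderiv : ∀ t ∈ Set.Ici (0 : ℝ), HasDerivAt
      (fun t : ℝ => -(1 / γ) * ((t : ℂ) ^ 1 * Complex.exp (-γ * t)) -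
        1 / γ ^ 2 * ((t : ℂ) ^ 0 * Complex.exp (-γ * t)))
      ((t : ℂ) * Complex.exp (-γ * t)) t := by
    intro t _
    have hid : HasDerivAt (fun t : ℝ => (t : ℂ)) 1 t := Complex.ofRealCLM.hasDerivAt
    have hexp := (hid.const_mul (-γ)).cexp
    convert! (((hid.pow 1).mul hexp).const_mul (-(1 / γ))).sub
      (((hid.pow 0).mul hexp).const_mul (1 / γ ^ 2)) using 1
    simp
    field_simp
    ring
  have hlim := ((tendsto_pow_mul_cexp_neg_mul_atTop 1 hγ).const_mul (-(1 / γ))).sub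
    ((tendsto_pow_mul_cexp_neg_mul_atTop 0 hγ).const_mul (1 / γ ^ 2))
  rw [integral_Ioi_of_hasDerivAt_of_tendsto' hderiv (integrableOn_id_mul_cexp_neg_mul hγ) hlim]
  simp

/-- Lemma 6.1: for `γ = γ₁ + iγ₂` with `γ₁ > 0` and `γ₂ ≪ γ₁ (log(1/γ₁))^A`, as `γ₁ → 0⁺`,
`∫_2^∞ (t log log t / log t) e^{−γt} dt
  = log log(1/γ₁)/(γ² log(1/γ₁)) + O(log log(1/γ₁)/(γ₁² (log(1/γ₁))²))`. -/
theorem complex_laplace_integral (A c : ℝ) (hA : 0 < A) (hc : 0 < c) :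
    ∃ C : ℝ, 0 < C ∧ ∃ ε : ℝ, 0 < ε ∧
      ∀ γ : ℂ, 0 < γ.re → γ.re < ε →
        |γ.im| ≤ c * γ.re * (Real.log (1/γ.re)) ^ A →
        ‖(∫ t in Set.Ioi (2:ℝ),
              ((t * Real.log (Real.log t) / Real.log t : ℝ) : ℂ) * Complex.exp (-γ * t)) -
            (Real.log (Real.log (1/γ.re)) : ℂ) / (γ^2 * (Real.log (1/γ.re) : ℂ))‖ ≤
          C * Real.log (Real.log (1/γ.re)) / (γ.re^2 * (Real.log (1/γ.re))^2) := by
  refine ⟨244, by norm_num, Real.exp (-Real.exp 1), Real.exp_pos _, fun γ ha haε _ => ?_⟩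
  have hLe : Real.exp 1 ≤ Real.log (1 / γ.re) := by
    rw [one_div, Real.log_inv]
    have := Real.log_le_log ha haε.le
    rw [Real.log_exp] at this
    linarith
  have hL : 2 ≤ Real.log (1 / γ.re) := by linarith [Real.exp_one_gt_d9]
  have hlog : 1 ≤ Real.log (Real.log (1 / γ.re)) := by
    rwa [Real.le_log_iff_exp_le (by linarith)]
  have hpt := fun t ht => mul_abs_loglog_div_log_sub_le (t := t) ha hL hlog ht
  have hLT : Real.log (1 / γ.re) ≤ 1 / γ.re := Real.log_le_self (by positivity)
  set a := γ.re
  set L := Real.log (1 / a)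
  set K := Real.log L / L ^ 2 with hK_def
  have hK : 0 < K := by positivity
  set F := Real.log L / L with hF_def
  have hF : 0 < F := by positivity
  let M : ℝ → ℝ := fun t =>
    80 * K * (1 / a) * (t ^ 0 * Real.exp (-a * t)) + 80 * K * a * (t ^ 2 * Real.exp (-a * t))
  have hM : IntegrableOn M (Set.Ioi 0) :=
    ((integrableOn_pow_mul_exp_neg_mul 0 ha).const_mul _).add
      ((integrableOn_pow_mul_exp_neg_mul 2 ha).const_mul _)
  have hM_int : ∫ t in Set.Ioi (0 : ℝ), M t = 240 * K / a ^ 2 := by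
    rw [integral_add ((integrableOn_pow_mul_exp_neg_mul 0 ha).const_mul _)
      ((integrableOn_pow_mul_exp_neg_mul 2 ha).const_mul _), integral_const_mul,
      integral_const_mul, integral_pow_mul_exp_neg_mul 0 ha, integral_pow_mul_exp_neg_mul 2 ha]
    simp only [Nat.factorial]
    field_simp
    norm_num
    ring
  have hsub : Set.Ioi (2 : ℝ) ⊆ Set.Ioi 0 := Set.Ioi_subset_Ioi (by norm_num)
  let D : ℝ → ℂ := fun t =>
    ((t * (Real.log (Real.log t) / Real.log t - F) : ℝ) : ℂ) * Complex.exp (-γ * t)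
  have hD_le : ∀ t ∈ Set.Ioi (2 : ℝ), ‖D t‖ ≤ M t := by
    intro t ht
    have ht₀ : (0 : ℝ) < t := hsub ht
    simp only [D, M]
    rw [norm_mul, norm_cexp_neg_mul_ofReal, Complex.norm_real, Real.norm_eq_abs, abs_mul,
      abs_of_pos ht₀]
    calc _ ≤ 80 * K * (1 / a + a * t ^ 2) * Real.exp (-a * t) := by
          exact mul_le_mul_of_nonneg_right (hpt t ht) (Real.exp_nonneg _)
      _ = _ := by ring
  have hD : IntegrableOn D (Set.Ioi 2) := by
    refine Integrable.mono' (hM.mono_set hsub) ?_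
      ((ae_restrict_iff' measurableSet_Ioi).2 (Eventually.of_forall hD_le))
    exact Measurable.aestronglyMeasurable (by fun_prop)
  let E : ℝ → ℂ := fun t => (t : ℂ) * Complex.exp (-γ * t)
  have hE : IntegrableOn E (Set.Ioi 0) := integrableOn_id_mul_cexp_neg_mul ha
  have hE_split : (∫ t in Set.Ioc (0 : ℝ) 2, E t) + ∫ t in Set.Ioi (2 : ℝ), E t = 1 / γ ^ 2 := by
    rw [← integral_id_mul_cexp_neg_mul ha, ← Set.Ioc_union_Ioi_eq_Ioi (zero_le_two (α := ℝ)),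
      setIntegral_union (Set.Ioc_disjoint_Ioi le_rfl) measurableSet_Ioi
        (hE.mono_set Set.Ioc_subset_Ioi_self) (hE.mono_set hsub)]
  have hmain : ∫ t in Set.Ioi (2 : ℝ),
      ((t * Real.log (Real.log t) / Real.log t : ℝ) : ℂ) * Complex.exp (-γ * t) =
      (∫ t in Set.Ioi (2 : ℝ), D t) + F * ∫ t in Set.Ioi (2 : ℝ), E t := by
    rw [← integral_const_mul, ← integral_add hD ((hE.mono_set hsub).const_mul _)]
    congr 1 with t
    simp only [D, E]
    push_cast
    ring
  have hFγ : (Real.log L : ℂ) / (γ ^ 2 * (L : ℂ)) = F * (1 / γ ^ 2) := by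
    rw [hF_def]
    push_cast
    ring
  have hD_norm : ‖∫ t in Set.Ioi (2 : ℝ), D t‖ ≤ 240 * K / a ^ 2 := by
    rw [← hM_int]
    refine (norm_integral_le_of_norm_le (hM.mono_set hsub)
      ((ae_restrict_iff' measurableSet_Ioi).2 (Eventually.of_forall hD_le))).trans ?_
    refine setIntegral_mono_set hM ?_ hsub.eventuallyLE
    refine (ae_restrict_iff' measurableSet_Ioi).2 (Eventually.of_forall fun t ht => ?_)
    simp only [M, Pi.zero_apply]
    positivity
  have hE_norm : ‖∫ t in Set.Ioc (0 : ℝ) 2, E t‖ ≤ 4 := by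
    have := norm_setIntegral_le_of_norm_le_const (μ := volume) (s := Set.Ioc (0 : ℝ) 2)
      (f := E) (C := 2) (by simp) (fun t ht => ?_)
    · refine this.trans ?_
      simp
      norm_num
    · simp only [E]
      rw [norm_mul, norm_cexp_neg_mul_ofReal, Complex.norm_real, Real.norm_eq_abs,
        abs_of_pos ht.1]
      calc t * Real.exp (-γ.re * t) ≤ 2 * 1 := by
            gcongr
            · exact ht.2
            · rw [Real.exp_le_one_iff]
              nlinarith [ht.1]
        _ = 2 := by norm_num
  have hF_le : F ≤ K / a ^ 2 := by
    have h₁ : L ≤ (1 / a) ^ 2 := by nlinarith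
    calc F = K * L := by
          rw [hF_def, hK_def]
          field_simp
      _ ≤ K * (1 / a) ^ 2 := by gcongr
      _ = K / a ^ 2 := by ring
  rw [hmain, hFγ, ← hE_split]
  calc _ = ‖(∫ t in Set.Ioi (2 : ℝ), D t) - F * ∫ t in Set.Ioc (0 : ℝ) 2, E t‖ := by
        congr 1
        ring
    _ ≤ ‖∫ t in Set.Ioi (2 : ℝ), D t‖ + ‖(F : ℂ) * ∫ t in Set.Ioc (0 : ℝ) 2, E t‖ :=
        norm_sub_le _ _
    _ ≤ 240 * K / a ^ 2 + K / a ^ 2 * 4 := by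
        rw [norm_mul, Complex.norm_real, Real.norm_of_nonneg hF.le]
        gcongr
    _ = _ := by
        rw [hK_def]
        field_simp
        norm_num

end
end
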